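/- For the walk driven by −Δ^#, with positive probability X_n · (log 2)/(log n) → 1 as n → ∞, i.e. X_n ∼ (log n)/(log 2). -/

import Mathlib

open MeasureTheory Real Filter Set

noncomputable section

/-- Number of crossings of the edge `{e, e+1}` (i.e. the half-integer edge `e + 1/2`)
before time `n`. -/
def locTime {Ω : Type*} (X : ℕ → Ω → ℤ) (n : ℕ) (e : ℤ) (ω : Ω) : ℕ :=
  ((Finset.range n).filter fun m => min (X m ω) (X (m + 1) ω) = e).card

/-- Local time profile seen from the walker: `ℓ_n(k + 1/2)`. -/
def shiftedProfile {Ω : Type*} (X : ℕ → Ω → ℤ) (n : ℕ) (k : ℤ) (ω : Ω) : ℕ :=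
  locTime X n (X n ω + k) ω

/-- `F(y) = e^y / (e^y + e^{-y})`. -/
def walkF (y : ℝ) : ℝ := Real.exp y / (Real.exp y + Real.exp (-y))

/-- The σ-algebra generated by `X_0, …, X_n`. -/
def walkFiltration {Ω : Type*} (X : ℕ → Ω → ℤ) (n : ℕ) : MeasurableSpace Ω :=
  ⨆ m ∈ Finset.range (n + 1), MeasurableSpace.comap (X m) inferInstance

/-- The drift `Δ^#(ℓ_n) = 2 ℓ_n(-3/2) - ℓ_n(-1/2) - ℓ_n(1/2)`. -/
def Δsharp {Ω : Type*} (X : ℕ → Ω → ℤ) (n : ℕ) (ω : Ω) : ℝ :=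
  2 * (shiftedProfile X n (-2) ω : ℝ) - shiftedProfile X n (-1) ω - shiftedProfile X n 0 ω

/-! ### The deterministic invariant -/

/-- A configuration at time `n`, with the walker at `x` and edge local times `L`, whose rightmost
visited site is `m + 2`: the local times roughly double from each edge to the next one, and the
walker is within distance two of the rightmost visited site. -/
structure Doubling (n : ℕ) (x : ℤ) (L : ℤ → ℤ) (m : ℕ) : Prop where
  left_eq : L (-1) = 0
  first_eq : L 0 = 13
  right_eq : ∀ k : ℤ, m + 2 ≤ k → L k = 0
  nonneg : ∀ k, 0 ≤ L k
  pos : (x = m ∧ 1 ≤ m) ∨ x = m + 1 ∨ x = m + 2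
  total : (n : ℤ) = ∑ k ∈ Finset.range (m + 2), L k
  lower : ∀ k : ℕ, k + 1 ≤ m → 2 * L k ≤ L (k + 1) + (k + 7)
  upper : ∀ k : ℕ, k ≤ m → L (k + 1) ≤ 2 * L k + k + 10
  upper_left : x = m → L m + 1 ≤ 2 * L (m - 1) + m + 9
  upper_right : x ≠ m + 2 → L (m + 1) + 1 ≤ 2 * L m + m + 10

namespace Doubling

variable {n m : ℕ} {x : ℤ} {L : ℤ → ℤ}

lemma le_localTime (h : Doubling n x L m) (k : ℕ) (hk : k ≤ m) :
    (k : ℤ) + 8 + 5 * 2 ^ k ≤ L k := by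
  induction k with
  | zero => simp [h.first_eq]
  | succ k ih =>
    have h1 := ih (by omega)
    have h2 := h.lower k hk
    push_cast
    rw [pow_succ]
    linarith

lemma localTime_le (h : Doubling n x L m) (k : ℕ) (hk : k ≤ m + 1) :
    L k ≤ 24 * 2 ^ k - (k + 11) := by
  induction k with
  | zero => simp [h.first_eq]
  | succ k ih =>
    have h1 := ih (by omega)
    have h2 := h.upper k (by omega)
    push_cast
    rw [pow_succ]
    linarith

lemma time_le (h : Doubling n x L m) : n ≤ 2 ^ (m + 7) := by
  have key : ∀ j : ℕ, j ≤ m + 2 → ∑ k ∈ Finset.range j, L k ≤ 24 * 2 ^ j := by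
    intro j
    induction j with
    | zero => simp
    | succ j ih =>
      intro hj
      have h1 := ih (by omega)
      have h2 := h.localTime_le j (by omega)
      rw [Finset.sum_range_succ, pow_succ]
      linarith
  have h1 := key (m + 2) le_rfl
  rw [← h.total] at h1
  have h2 : (0 : ℤ) < 2 ^ m := by positivity
  have : (n : ℤ) ≤ 2 ^ (m + 7) := by
    rw [pow_add] at h1 ⊢
    linarith
  exact_mod_cast this

lemma pow_le_time (h : Doubling n x L m) : 2 ^ m ≤ n := by
  have h1 : L (m : ℕ) ≤ ∑ k ∈ Finset.range (m + 2), L k :=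
    Finset.single_le_sum (f := fun k : ℕ => L k) (fun k _ => h.nonneg k) (by simp)
  rw [← h.total] at h1
  have h2 := h.le_localTime m le_rfl
  have h3 : (0 : ℤ) < 2 ^ m := by positivity
  have : (2 : ℤ) ^ m ≤ n := by linarith
  exact_mod_cast this

/-- A walker never stepping against a drift of size at least `m + 7` preserves the invariant. -/
lemma step (h : Doubling n x L m) {x' : ℤ} {L' : ℤ → ℤ}
    (hx : |x' - x| = 1)
    (hL : ∀ k, L' k = L k + if min x x' = k then 1 else 0)
    (hneg : L (x - 1) + L x - 2 * L (x - 2) ≤ -(m + 7) → x' ≠ x + 1)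
    (hpos : (m : ℤ) + 7 ≤ L (x - 1) + L x - 2 * L (x - 2) → x' = x + 1) :
    ∃ m', Doubling (n + 1) x' L' m' := by
  have hsum : ∀ j : ℕ, 0 ≤ min x x' → min x x' < j →
      ∑ k ∈ Finset.range j, L' k = ∑ k ∈ Finset.range j, L k + 1 := by
    intro j h0 hj
    obtain ⟨e, he⟩ := Int.eq_ofNat_of_zero_le h0
    simp only [hL, Finset.sum_add_distrib, he, Nat.cast_inj]
    rw [Finset.sum_ite_eq, if_pos]
    simp only [Finset.mem_range]
    omega
  have hb := h.nonneg (m + 1)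
  have hstep : x' = x + 1 ∨ x' = x - 1 := by
    rcases abs_eq (zero_le_one) |>.1 hx with h | h
    · left; omega
    · right; omega
  have hbig := h.le_localTime m le_rfl
  rcases h.pos with ⟨rfl, hm⟩ | rfl | rfl
  · -- the walker is two steps behind the front and is forced to step right
    have hforce : x' = m + 1 := by
      apply hpos
      obtain ⟨j, rfl⟩ : ∃ j, m = j + 1 := ⟨m - 1, by omega⟩
      have hpow : (j : ℤ) + 2 ≤ 2 ^ (j + 1) := by
        have : j + 1 < 2 ^ (j + 1) := Nat.lt_two_pow_self
        exact_mod_cast this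
      push_cast at hbig ⊢
      rcases j with _ | j
      · have h1 := h.left_eq
        have h2 := h.first_eq
        norm_num at hbig ⊢
        rw [h1, h2]
        linarith
      · have h1 := h.lower j (by omega)
        have e1 : ((j + 1 : ℕ) : ℤ) + 1 - 1 = j + 1 := by push_cast; ring
        have e2 : ((j + 1 : ℕ) : ℤ) + 1 - 2 = j := by push_cast; ring
        rw [e1, e2]
        push_cast at *
        linarith
    subst hforce
    have he : min (m : ℤ) (m + 1) = m := by omega
    rw [he] at hL hsum
    refine ⟨m, ⟨?_, ?_, ?_, ?_, ?_, ?_, ?_, ?_, ?_, ?_⟩⟩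
    · rw [hL, if_neg (by omega), h.left_eq]; rfl
    · rw [hL, if_neg (by omega), h.first_eq]; rfl
    · intro k hk
      rw [hL, if_neg (by omega), h.right_eq k hk]; rfl
    · intro k
      rw [hL]
      have := h.nonneg k
      split_ifs <;> omega
    · right; left; rfl
    · rw [hsum _ (by omega) (by omega), ← h.total]; push_cast; rfl
    · intro k hk
      have := h.lower k hk
      rw [hL, hL, if_neg (by omega)]
      split_ifs <;> omega
    · intro k hk
      have h1 := h.upper k hk
      rw [hL, hL]
      by_cases hkm : (m : ℤ) = k + 1
      · have h2 := h.upper_left rfl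
        have e : (m : ℤ) - 1 = k := by omega
        rw [e, hkm] at h2
        rw [if_pos hkm, if_neg (by omega)]
        omega
      · rw [if_neg hkm]
        split_ifs <;> omega
    · intro h1; omega
    · intro _
      have := h.upper_right (by omega)
      rw [hL, hL, if_neg (by omega), if_pos rfl]
      omega
  · -- the walker is one step behind the front
    have hub := h.upper_right (by omega)
    have e1 : (m : ℤ) + 1 - 1 = m := by ring
    have e2 : (m : ℤ) + 1 - 2 = m - 1 := by ring
    rw [e1, e2] at hpos
    rcases hstep with rfl | rfl
    · have he : min ((m : ℤ) + 1) (m + 1 + 1) = m + 1 := by omega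
      rw [he] at hL hsum
      refine ⟨m, ⟨?_, ?_, ?_, ?_, ?_, ?_, ?_, ?_, ?_, ?_⟩⟩
      · rw [hL, if_neg (by omega), h.left_eq]; rfl
      · rw [hL, if_neg (by omega), h.first_eq]; rfl
      · intro k hk
        rw [hL, if_neg (by omega), h.right_eq k hk]; rfl
      · intro k
        rw [hL]
        have := h.nonneg k
        split_ifs <;> omega
      · right; right; ring
      · rw [hsum _ (by omega) (by push_cast; omega), ← h.total]; push_cast; rfl
      · intro k hk
        have := h.lower k hk
        rw [hL, hL, if_neg (by omega), if_neg (by omega)]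
        omega
      · intro k hk
        have h1 := h.upper k hk
        rw [hL, hL, if_neg (by omega : ¬ (m : ℤ) + 1 = k)]
        by_cases hkm : k = m
        · subst hkm
          rw [if_pos rfl]
          omega
        · rw [if_neg (by omega)]
          omega
      · intro h1; omega
      · intro h1; omega
    · have hd : L m + L (m + 1) - 2 * L (m - 1) < m + 7 := by
        by_contra hcon
        have := hpos (by omega)
        omega
      have hm : 1 ≤ m := by
        by_contra hcon
        obtain rfl : m = 0 := by omega
        have h1 := h.left_eq
        have h2 := h.first_eq
        norm_num at hd hb
        rw [h1, h2] at hd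
        linarith
      have he : min ((m : ℤ) + 1) (m + 1 - 1) = m := by omega
      rw [he] at hL hsum
      refine ⟨m, ⟨?_, ?_, ?_, ?_, ?_, ?_, ?_, ?_, ?_, ?_⟩⟩
      · rw [hL, if_neg (by omega), h.left_eq]; rfl
      · rw [hL, if_neg (by omega), h.first_eq]; rfl
      · intro k hk
        rw [hL, if_neg (by omega), h.right_eq k hk]; rfl
      · intro k
        rw [hL]
        have := h.nonneg k
        split_ifs <;> omega
      · left; exact ⟨by ring, hm⟩
      · rw [hsum _ (by omega) (by push_cast; omega), ← h.total]; push_cast; rfl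
      · intro k hk
        have := h.lower k hk
        rw [hL, hL, if_neg (by omega)]
        split_ifs <;> omega
      · intro k hk
        have h1 := h.upper k hk
        rw [hL, hL]
        by_cases hkm : (m : ℤ) = k + 1
        · have e : (m : ℤ) - 1 = k := by omega
          rw [e, hkm] at hd
          rw [hkm] at hb
          rw [if_pos hkm, if_neg (by omega)]
          omega
        · rw [if_neg hkm]
          split_ifs <;> omega
      · intro _
        rw [hL, hL, if_pos rfl, if_neg (by omega)]
        omega
      · intro _
        rw [hL, hL, if_neg (by omega), if_pos rfl]
        omega
  · -- the walker is at the front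
    have e1 : (m : ℤ) + 2 - 1 = m + 1 := by ring
    have e2 : (m : ℤ) + 2 - 2 = m := by ring
    have hc := h.right_eq (m + 2) le_rfl
    rw [e1, e2, hc] at hpos hneg
    have hub := h.upper m le_rfl
    rcases hstep with rfl | rfl
    · have hd : -((m : ℤ) + 7) < L (m + 1) - 2 * L m := by
        by_contra hcon
        exact hneg (by omega) rfl
      have he : min ((m : ℤ) + 2) (m + 2 + 1) = m + 2 := by omega
      rw [he] at hL hsum
      refine ⟨m + 1, ⟨?_, ?_, ?_, ?_, ?_, ?_, ?_, ?_, ?_, ?_⟩⟩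
      · rw [hL, if_neg (by omega), h.left_eq]; rfl
      · rw [hL, if_neg (by omega), h.first_eq]; rfl
      · intro k hk
        push_cast at hk
        rw [hL, if_neg (by omega), h.right_eq k (by omega)]; rfl
      · intro k
        rw [hL]
        have := h.nonneg k
        split_ifs <;> omega
      · right; right; push_cast; ring
      · rw [hsum _ (by omega) (by push_cast; omega), Finset.sum_range_succ, ← h.total]
        push_cast
        rw [hc]
        ring
      · intro k hk
        rw [hL, hL, if_neg (by omega), if_neg (by omega)]
        by_cases hkm : k = m
        · subst hkm
          omega
        · have := h.lower k (by omega)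
          omega
      · intro k hk
        rw [hL, hL, if_neg (by omega : ¬ (m : ℤ) + 2 = k)]
        by_cases hkm : k = m + 1
        · subst hkm
          push_cast
          have e : (m : ℤ) + 1 + 1 = m + 2 := by ring
          rw [if_pos (by ring), e, hc]
          omega
        · have := h.upper k (by omega)
          rw [if_neg (by omega)]
          omega
      · intro h1; push_cast at h1; omega
      · intro h1; push_cast at h1; omega
    · have hd : L (m + 1) - 2 * L m < m + 7 := by
        by_contra hcon
        have := hpos (by omega)
        omega
      have he : min ((m : ℤ) + 2) (m + 2 - 1) = m + 1 := by omega
      rw [he] at hL hsum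
      refine ⟨m, ⟨?_, ?_, ?_, ?_, ?_, ?_, ?_, ?_, ?_, ?_⟩⟩
      · rw [hL, if_neg (by omega), h.left_eq]; rfl
      · rw [hL, if_neg (by omega), h.first_eq]; rfl
      · intro k hk
        rw [hL, if_neg (by omega), h.right_eq k hk]; rfl
      · intro k
        rw [hL]
        have := h.nonneg k
        split_ifs <;> omega
      · right; left; ring
      · rw [hsum _ (by omega) (by push_cast; omega), ← h.total]; push_cast; rfl
      · intro k hk
        have := h.lower k hk
        rw [hL, hL, if_neg (by omega), if_neg (by omega)]
        omega
      · intro k hk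
        have h1 := h.upper k hk
        rw [hL, hL, if_neg (by omega : ¬ (m : ℤ) + 1 = k)]
        by_cases hkm : k = m
        · subst hkm
          rw [if_pos rfl]
          omega
        · rw [if_neg (by omega)]
          omega
      · intro h1; omega
      · intro _
        rw [hL, hL, if_pos rfl, if_neg (by omega)]
        omega

end Doubling

/-! ### The driving function -/

lemma walkF_pos (y : ℝ) : 0 < walkF y := by
  unfold walkF; positivity

lemma one_sub_walkF (y : ℝ) : 1 - walkF y = walkF (-y) := by
  have : 0 < Real.exp y + Real.exp (-y) := by positivity
  unfold walkF
  rw [neg_neg, add_comm (Real.exp (-y))]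
  field_simp
  ring

lemma walkF_le {n j : ℕ} {y : ℝ} (hn : 0 < n) (hnj : n ≤ 2 ^ j) (hy : y ≤ -(j : ℝ)) :
    walkF y ≤ 1 / (n : ℝ) ^ 2 := by
  have hn' : (0 : ℝ) < n := by exact_mod_cast hn
  have h1 : (n : ℝ) ≤ Real.exp (-y) := by
    calc (n : ℝ) ≤ 2 ^ j := by exact_mod_cast hnj
      _ ≤ Real.exp 1 ^ j := by
        have := Real.add_one_le_exp 1
        gcongr
        linarith
      _ = Real.exp j := by rw [← Real.exp_nat_mul, mul_one]
      _ ≤ Real.exp (-y) := Real.exp_le_exp.2 (by linarith)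
  have h2 : (n : ℝ) ^ 2 * Real.exp y ≤ Real.exp (-y) := by
    calc (n : ℝ) ^ 2 * Real.exp y ≤ Real.exp (-y) ^ 2 * Real.exp y := by gcongr
      _ = Real.exp (-y) := by rw [← Real.exp_nat_mul, ← Real.exp_add]; congr 1; push_cast; ring
  have h3 := Real.exp_pos y
  unfold walkF
  rw [div_le_div_iff₀ (by positivity) (by positivity)]
  linarith

/-! ### The filtration and one step of the walk -/

section Walk

variable {Ω : Type*} {X : ℕ → Ω → ℤ} {n : ℕ}

lemma measurableSet_walkFiltration {S : Set Ω}
    (h : ∀ ω ω', (∀ m ≤ n, X m ω = X m ω') → ω ∈ S → ω' ∈ S) :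
    MeasurableSet[walkFiltration X n] S := by
  let φ : Ω → (Fin (n + 1) → ℤ) := fun ω i => X i ω
  have hφ : Measurable[walkFiltration X n] φ := by
    refine @measurable_pi_lambda _ _ _ (walkFiltration X n) _ _ fun i => ?_
    refine Measurable.mono (comap_measurable (X i)) ?_ le_rfl
    exact le_iSup₂_of_le (i : ℕ) (Finset.mem_range.2 i.2) le_rfl
  have hS : S = φ ⁻¹' (φ '' S) := by
    refine (subset_preimage_image φ S).antisymm ?_
    rintro ω' ⟨ω, hω, he⟩
    exact h ω ω' (fun m hm => congrFun he ⟨m, by omega⟩) hω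
  rw [hS]
  exact hφ (to_countable _).measurableSet

lemma locTime_congr {ω ω' : Ω} (h : ∀ m ≤ n, X m ω = X m ω') (e : ℤ) :
    locTime X n e ω = locTime X n e ω' := by
  unfold locTime
  congr 1
  refine Finset.filter_congr fun m hm => ?_
  rw [Finset.mem_range] at hm
  rw [h m (by omega), h (m + 1) (by omega)]

lemma Δsharp_congr {ω ω' : Ω} (h : ∀ m ≤ n, X m ω = X m ω') :
    Δsharp X n ω = Δsharp X n ω' := by
  simp only [Δsharp, shiftedProfile, locTime_congr h, h n le_rfl]

lemma locTime_succ (e : ℤ) (ω : Ω) :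
    locTime X (n + 1) e ω
      = locTime X n e ω + if min (X n ω) (X (n + 1) ω) = e then 1 else 0 := by
  unfold locTime
  rw [Finset.range_add_one, Finset.filter_insert]
  split_ifs
  · rw [Finset.card_insert_of_notMem (by simp)]
  · rfl

/-- The trajectory of `ω` is in a doubling configuration at time `n`. -/
def IsDoubling (X : ℕ → Ω → ℤ) (n : ℕ) (ω : Ω) : Prop :=
  ∃ m, Doubling n (X n ω) (fun k => (locTime X n k ω : ℤ)) m

lemma IsDoubling.congr {ω ω' : Ω} (h : ∀ m ≤ n, X m ω = X m ω') (hω : IsDoubling X n ω) :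
    IsDoubling X n ω' := by
  simpa only [IsDoubling, locTime_congr h, h n le_rfl] using hω

lemma IsDoubling.succ {ω : Ω} (h : IsDoubling X n ω) (hn : 0 < n)
    (hstep : |X (n + 1) ω - X n ω| = 1)
    (hright : walkF (-Δsharp X n ω) ≤ 1 / (n : ℝ) ^ 2 → X (n + 1) ω ≠ X n ω + 1)
    (hleft : 1 - walkF (-Δsharp X n ω) ≤ 1 / (n : ℝ) ^ 2 → X (n + 1) ω = X n ω + 1) :
    IsDoubling X (n + 1) ω := by
  obtain ⟨m, hm⟩ := h
  have hΔ : -Δsharp X n ω = (((locTime X n (X n ω - 1) ω : ℤ) + (locTime X n (X n ω) ω : ℤ)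
      - 2 * (locTime X n (X n ω - 2) ω : ℤ) : ℤ) : ℝ) := by
    simp only [Δsharp, shiftedProfile, add_zero, ← sub_eq_add_neg]
    push_cast
    ring
  refine hm.step hstep (fun k => ?_) (fun hd => hright ?_) (fun hd => hleft ?_)
  · rw [locTime_succ]
    push_cast
    rfl
  · refine walkF_le hn hm.time_le ?_
    rw [hΔ]
    exact_mod_cast hd
  · rw [one_sub_walkF]
    refine walkF_le hn hm.time_le ?_
    rw [hΔ, neg_le_neg_iff]
    exact_mod_cast hd

/-- Oscillating on the first edge and then leaving it produces a doubling configuration. -/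
lemma isDoubling_of_oscillation {ω : Ω} (h : ∀ m ≤ 13, X m ω = ((m % 2 : ℕ) : ℤ))
    (h' : X 14 ω = 2) : IsDoubling X 14 ω := by
  have hL : ∀ e : ℤ, locTime X 14 e ω
      = (if e = 0 then 13 else 0) + if e = 1 then 1 else 0 := by
    intro e
    have h13 : locTime X 13 e ω = if e = 0 then 13 else 0 := by
      unfold locTime
      have : ∀ m ∈ Finset.range 13, (min (X m ω) (X (m + 1) ω) = e ↔ e = 0) := by
        intro m hm
        rw [Finset.mem_range] at hm
        rw [h m (by omega), h (m + 1) (by omega)]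
        omega
      rw [Finset.filter_congr this]
      split_ifs with he <;> simp [he]
    rw [locTime_succ, h13, h 13 le_rfl, h']
    congr 1
    norm_num [eq_comm]
  refine ⟨0, ?_⟩
  simp only [hL, h']
  constructor <;> norm_num [Finset.sum_range_succ]
  · intro k hk
    rw [if_neg (by omega), if_neg (by omega)]
    rfl
  · intro k
    split_ifs <;> norm_num

lemma tendsto_of_isDoubling {ω : Ω} (h : ∀ n, 14 ≤ n → IsDoubling X n ω) :
    Tendsto (fun n : ℕ => (X n ω : ℝ) * Real.log 2 / Real.log n) atTop (nhds 1) := by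
  have hlog : Tendsto (fun n : ℕ => Real.log n) atTop atTop :=
    Real.tendsto_log_atTop.comp tendsto_natCast_atTop_atTop
  have hlog2 : 0 < Real.log 2 := Real.log_pos one_lt_two
  have hbound : ∀ n : ℕ, 14 ≤ n →
      |(X n ω : ℝ) * Real.log 2 - Real.log n| ≤ 7 * Real.log 2 := by
    intro n hn
    obtain ⟨m, hm⟩ := h n hn
    have hn' : (0 : ℝ) < n := by positivity
    have h1 : (m : ℝ) * Real.log 2 ≤ Real.log n := by
      rw [← Real.log_pow]
      exact Real.log_le_log (by positivity) (by exact_mod_cast hm.pow_le_time)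
    have h2 : Real.log n ≤ (m + 7) * Real.log 2 := by
      have := Real.log_le_log hn' (show (n : ℝ) ≤ 2 ^ (m + 7) by exact_mod_cast hm.time_le)
      rw [Real.log_pow] at this
      exact_mod_cast this
    have h3 : (m : ℝ) ≤ X n ω := by
      have : (m : ℤ) ≤ X n ω := by have := hm.pos; omega
      exact_mod_cast this
    have h4 : (X n ω : ℝ) ≤ m + 2 := by
      have : X n ω ≤ (m : ℤ) + 2 := by have := hm.pos; omega
      exact_mod_cast this
    rw [abs_le]
    constructor <;> nlinarith
  have hzero : Tendsto (fun n : ℕ => 7 * Real.log 2 / Real.log n) atTop (nhds 0) :=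
    hlog.const_div_atTop _
  rw [tendsto_iff_dist_tendsto_zero]
  refine squeeze_zero' (Eventually.of_forall fun _ => dist_nonneg) ?_ hzero
  filter_upwards [eventually_ge_atTop 14] with n hn
  have hpos : 0 < Real.log n := Real.log_pos (by exact_mod_cast (by omega : 1 < n))
  rw [Real.dist_eq, div_sub_one hpos.ne', abs_div, abs_of_pos hpos]
  exact div_le_div_of_nonneg_right (hbound n hn) hpos.le

/-- The event that the walk is in a doubling configuration from time `14` up to time `n`. -/
def doublingUpTo (X : ℕ → Ω → ℤ) (n : ℕ) : Set Ω := {ω | ∀ m, 14 ≤ m → m ≤ n → IsDoubling X m ω}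

lemma measurableSet_doublingUpTo : MeasurableSet[walkFiltration X n] (doublingUpTo X n) :=
  measurableSet_walkFiltration fun _ _ h hω m hm hmn =>
    (hω m hm hmn).congr fun j hj => h j (hj.trans hmn)

variable [MeasurableSpace Ω] {μ : Measure Ω}

lemma setIntegral_pos_of_forall_pos {f : Ω → ℝ} (hf : Integrable f μ) (hpos : ∀ ω, 0 < f ω)
    {E : Set Ω} (hE : μ E ≠ 0) : 0 < ∫ ω in E, f ω ∂μ := by
  rw [integral_pos_iff_support_of_nonneg (fun ω => (hpos ω).le) hf.integrableOn]
  have : Function.support f = univ := by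
    ext ω
    simp [(hpos ω).ne']
  rw [this, Measure.restrict_apply_univ]
  exact pos_iff_ne_zero.2 hE

lemma integrable_walkF
    (hdrive : μ[(fun ω => if X (n + 1) ω = X n ω + 1 then (1 : ℝ) else 0) | walkFiltration X n]
        =ᵐ[μ] fun ω => walkF (-(Δsharp X n ω))) :
    Integrable (fun ω => walkF (-(Δsharp X n ω))) μ :=
  integrable_condExp.congr hdrive

variable [IsProbabilityMeasure μ]

lemma walkFiltration_le (hmeas : ∀ n, Measurable (X n)) (n : ℕ) :
    walkFiltration X n ≤ ‹MeasurableSpace Ω› :=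
  iSup₂_le fun m _ => (hmeas m).comap_le

/-- The event that the step after time `n` goes to the right. -/
def stepRight (X : ℕ → Ω → ℤ) (n : ℕ) : Set Ω := {ω | X (n + 1) ω = X n ω + 1}

lemma measurableSet_stepRight (hmeas : ∀ n, Measurable (X n)) :
    MeasurableSet (stepRight X n) :=
  measurableSet_eq_fun (hmeas _) ((hmeas n).add_const 1)

lemma measureReal_inter_stepRight (hmeas : ∀ n, Measurable (X n))
    (hdrive : μ[(fun ω => if X (n + 1) ω = X n ω + 1 then (1 : ℝ) else 0) | walkFiltration X n]
        =ᵐ[μ] fun ω => walkF (-(Δsharp X n ω)))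
    {E : Set Ω} (hE : MeasurableSet[walkFiltration X n] E) :
    μ.real (E ∩ stepRight X n) = ∫ ω in E, walkF (-(Δsharp X n ω)) ∂μ := by
  have hR := measurableSet_stepRight (n := n) hmeas
  have hind : (fun ω => if X (n + 1) ω = X n ω + 1 then (1 : ℝ) else 0)
      = (stepRight X n).indicator 1 := by
    ext ω
    simp [stepRight, Set.indicator_apply]
  have hint : Integrable (fun ω => if X (n + 1) ω = X n ω + 1 then (1 : ℝ) else 0) μ := by
    rw [hind]
    exact (integrable_const (1 : ℝ)).indicator hR
  rw [← setIntegral_congr_ae (walkFiltration_le hmeas n _ hE)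
    (hdrive.mono fun ω hω _ => hω), setIntegral_condExp (walkFiltration_le hmeas n) hint hE,
    hind, integral_indicator_one hR, measureReal_restrict_apply hR, inter_comm]

lemma measureReal_diff_stepRight (hmeas : ∀ n, Measurable (X n))
    (hdrive : μ[(fun ω => if X (n + 1) ω = X n ω + 1 then (1 : ℝ) else 0) | walkFiltration X n]
        =ᵐ[μ] fun ω => walkF (-(Δsharp X n ω)))
    {E : Set Ω} (hE : MeasurableSet[walkFiltration X n] E) :
    μ.real (E \ stepRight X n) = ∫ ω in E, (1 - walkF (-(Δsharp X n ω))) ∂μ := by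
  rw [integral_sub (integrable_const _).integrableOn (integrable_walkF hdrive).integrableOn,
    ← measureReal_inter_stepRight hmeas hdrive hE, setIntegral_const, smul_eq_mul, mul_one,
    eq_sub_iff_add_eq, measureReal_sdiff_add_inter (measurableSet_stepRight hmeas)]

/-- Every finite nearest-neighbour path is followed with positive probability. -/
lemma measure_path_ne_zero (hmeas : ∀ n, Measurable (X n))
    (hX0 : ∀ᵐ ω ∂μ, X 0 ω = 0)
    (hstep : ∀ n, ∀ᵐ ω ∂μ, |X (n + 1) ω - X n ω| = 1)
    (hdrive : ∀ n,
      μ[(fun ω => if X (n + 1) ω = X n ω + 1 then (1 : ℝ) else 0) | walkFiltration X n]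
        =ᵐ[μ] fun ω => walkF (-(Δsharp X n ω)))
    (p : ℕ → ℤ) (hp0 : p 0 = 0) (N : ℕ) (hp : ∀ n < N, p (n + 1) = p n + 1 ∨ p (n + 1) = p n - 1) :
    μ {ω | ∀ m ≤ N, X m ω = p m} ≠ 0 := by
  induction N with
  | zero =>
    have h1 : ∀ᵐ ω ∂μ, ∀ m ≤ 0, X m ω = p m := by
      filter_upwards [hX0] with ω hω m hm
      rw [Nat.le_zero.1 hm, hω, hp0]
    intro h0
    exact IsProbabilityMeasure.ne_zero μ (ae_eq_bot.1 (by
      simpa using h1.and (measure_eq_zero_iff_ae_notMem.1 h0)))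
  | succ N ih =>
    set E : Set Ω := {ω | ∀ m ≤ N, X m ω = p m} with hEdef
    have hE0 : μ E ≠ 0 := ih fun n hn => hp n (by omega)
    have hE : MeasurableSet[walkFiltration X N] E :=
      measurableSet_walkFiltration fun ω ω' h hω m hm => (h m hm).symm.trans (hω m hm)
    rcases hp N (by omega) with hN | hN
    · have h1 := setIntegral_pos_of_forall_pos (integrable_walkF (hdrive N))
        (fun ω => walkF_pos _) hE0
      rw [← measureReal_inter_stepRight hmeas (hdrive N) hE] at h1
      intro h0
      refine h1.ne' ((measureReal_eq_zero_iff).2 (measure_mono_null ?_ h0))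
      rintro ω ⟨hω, hR⟩ m hm
      rcases Nat.le_succ_iff.1 hm with hm | rfl
      · exact hω m hm
      · rw [hN, ← hω N le_rfl]
        exact hR
    · have h1 := setIntegral_pos_of_forall_pos
        ((integrable_const (1 : ℝ)).sub (integrable_walkF (hdrive N)))
        (fun ω => by
          simp only [Pi.sub_apply]
          rw [one_sub_walkF]
          exact walkF_pos _) hE0
      simp only [Pi.sub_apply] at h1
      rw [← measureReal_diff_stepRight hmeas (hdrive N) hE] at h1
      intro h0
      refine h1.ne' ((measureReal_eq_zero_iff).2 ?_)
      rw [← nonpos_iff_eq_zero, ← h0]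
      refine measure_mono_ae ?_
      filter_upwards [hstep N] with ω hs hω m hm
      obtain ⟨hω, hR⟩ := hω
      rcases Nat.le_succ_iff.1 hm with hm | rfl
      · exact hω m hm
      · change X (N + 1) ω = p (N + 1)
        have h2 := hω N le_rfl
        have h3 : X (N + 1) ω ≠ X N ω + 1 := hR
        rcases (abs_eq zero_le_one).1 hs with h4 | h4 <;> omega

lemma le_measureReal_doublingUpTo_succ (hmeas : ∀ n, Measurable (X n))
    (hstep : ∀ᵐ ω ∂μ, |X (n + 1) ω - X n ω| = 1)
    (hdrive : μ[(fun ω => if X (n + 1) ω = X n ω + 1 then (1 : ℝ) else 0) | walkFiltration X n]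
        =ᵐ[μ] fun ω => walkF (-(Δsharp X n ω)))
    (hn : 14 ≤ n) :
    (1 - 1 / (n : ℝ) ^ 2) * μ.real (doublingUpTo X n) ≤ μ.real (doublingUpTo X (n + 1)) := by
  set G := doublingUpTo X n
  set ε : ℝ := 1 / (n : ℝ) ^ 2 with hε
  have hε2 : ε < 1 / 2 := by
    have : (14 : ℝ) ≤ n := by exact_mod_cast hn
    rw [hε, div_lt_div_iff₀ (by positivity) (by positivity)]
    nlinarith
  have hG : MeasurableSet[walkFiltration X n] G := measurableSet_doublingUpTo
  set A : Set Ω := {ω | walkF (-Δsharp X n ω) ≤ ε}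
  set B : Set Ω := {ω | 1 - walkF (-Δsharp X n ω) ≤ ε}
  have hA : MeasurableSet[walkFiltration X n] (G ∩ A) :=
    MeasurableSet.inter hG <| measurableSet_walkFiltration fun ω ω' h hω => by
      simpa only [A, mem_ofPred_eq, Δsharp_congr h] using hω
  have hB : MeasurableSet[walkFiltration X n] (G ∩ B) :=
    MeasurableSet.inter hG <| measurableSet_walkFiltration fun ω ω' h hω => by
      simpa only [B, mem_ofPred_eq, Δsharp_congr h] using hω
  have hle := walkFiltration_le hmeas n
  have hF := integrable_walkF hdrive
  have h1 : μ.real (G ∩ A ∩ stepRight X n) ≤ ε * μ.real (G ∩ A) := by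
    rw [measureReal_inter_stepRight hmeas hdrive hA, mul_comm, ← smul_eq_mul, ← setIntegral_const]
    exact setIntegral_mono_on hF.integrableOn (integrable_const _).integrableOn (hle _ hA)
      fun ω hω => hω.2
  have h2 : μ.real ((G ∩ B) \ stepRight X n) ≤ ε * μ.real (G ∩ B) := by
    rw [measureReal_diff_stepRight hmeas hdrive hB, mul_comm, ← smul_eq_mul, ← setIntegral_const]
    exact setIntegral_mono_on ((integrable_const _).sub hF).integrableOn
      (integrable_const _).integrableOn (hle _ hB) fun ω hω => hω.2
  have h3 : μ.real (G ∩ A) + μ.real (G ∩ B) ≤ μ.real G := by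
    have hdisj : Disjoint (G ∩ A) (G ∩ B) := by
      rw [Set.disjoint_left]
      rintro ω ⟨-, hωA⟩ ⟨-, hωB⟩
      simp only [A, B, mem_ofPred_eq] at hωA hωB
      linarith
    rw [← measureReal_union hdisj (hle _ hB)]
    exact measureReal_mono (union_subset inter_subset_left inter_subset_left)
  have h4 : μ.real G ≤ μ.real (doublingUpTo X (n + 1)
      ∪ ((G ∩ A ∩ stepRight X n) ∪ ((G ∩ B) \ stepRight X n))) := by
    refine ENNReal.toReal_mono (measure_ne_top _ _) (measure_mono_ae ?_)
    filter_upwards [hstep] with ω hs (hω : ω ∈ G)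
    by_cases hbad : ω ∈ (G ∩ A ∩ stepRight X n) ∪ ((G ∩ B) \ stepRight X n)
    · exact Or.inr hbad
    · refine Or.inl fun m hm hmn => ?_
      rcases Nat.le_succ_iff.1 hmn with hmn | rfl
      · exact hω m hm hmn
      · refine (hω n hn le_rfl).succ (by omega) hs (fun ha hR => ?_) (fun hb => ?_)
        · exact hbad (Or.inl ⟨⟨hω, ha⟩, hR⟩)
        · by_contra hR
          exact hbad (Or.inr ⟨⟨hω, hb⟩, hR⟩)
  have h5 := measureReal_union_le (μ := μ) (doublingUpTo X (n + 1))
    ((G ∩ A ∩ stepRight X n) ∪ ((G ∩ B) \ stepRight X n))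
  have h6 := measureReal_union_le (μ := μ) (G ∩ A ∩ stepRight X n) ((G ∩ B) \ stepRight X n)
  have h7 : 0 ≤ ε := by positivity
  nlinarith

end Walk

/-- for the walk driven by `-Δ^#`, with positive probability
`X_n ∼ (log n)/(log 2)`. -/
theorem stmt17 {Ω : Type*} [MeasurableSpace Ω] (μ : Measure Ω) [IsProbabilityMeasure μ]
    (X : ℕ → Ω → ℤ) (hmeas : ∀ n, Measurable (X n))
    (hX0 : ∀ᵐ ω ∂μ, X 0 ω = 0)
    (hstep : ∀ n, ∀ᵐ ω ∂μ, |X (n + 1) ω - X n ω| = 1)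
    (hdrive : ∀ n,
      μ[(fun ω => if X (n + 1) ω = X n ω + 1 then (1 : ℝ) else 0) | walkFiltration X n]
        =ᵐ[μ] fun ω => walkF (-(Δsharp X n ω))) :
    0 < μ {ω | Tendsto (fun n : ℕ => (X n ω : ℝ) * Real.log 2 / Real.log n)
        atTop (nhds 1)} := by
  have hstart : 0 < μ.real (doublingUpTo X 14) := by
    let p : ℕ → ℤ := fun m => if m ≤ 13 then ((m % 2 : ℕ) : ℤ) else 2
    have hp := measure_path_ne_zero hmeas hX0 hstep hdrive p (by simp [p]) 14 (by
      intro n hn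
      simp only [p]
      split_ifs <;> omega)
    refine ENNReal.toReal_pos (fun h0 => hp (measure_mono_null ?_ h0)) (measure_ne_top _ _)
    intro ω hω m hm hm'
    obtain rfl : m = 14 := by omega
    refine isDoubling_of_oscillation (fun j hj => ?_) ?_
    · simpa [p, hj] using hω j (by omega)
    · simpa [p] using hω 14 le_rfl
  set c := μ.real (doublingUpTo X 14)
  -- the quantity `(1 - 1 / n) * μ.real (doublingUpTo X n)` is nondecreasing in `n`
  have hlower : ∀ n, 14 ≤ n → c * (13 / 14) ≤ μ.real (doublingUpTo X n) * ((n - 1) / n) := by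
    intro n hn
    induction n, hn using Nat.le_induction with
    | base => norm_num [c]
    | succ n hn ih =>
      have h1 := le_measureReal_doublingUpTo_succ hmeas (hstep n) (hdrive n) hn
      have hn' : (0 : ℝ) < n := by positivity
      refine ih.trans ?_
      calc μ.real (doublingUpTo X n) * ((n - 1) / n)
          = (1 - 1 / (n : ℝ) ^ 2) * μ.real (doublingUpTo X n) * (n / (n + 1)) := by
            field_simp
            ring
        _ ≤ μ.real (doublingUpTo X (n + 1)) * (n / (n + 1)) := by gcongr
        _ = _ := by push_cast; congr 2; ring
  have hanti : Antitone (doublingUpTo X) := fun i j hij ω hω m hm hmi => hω m hm (hmi.trans hij)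
  have hlim := tendsto_measure_iInter_atTop (μ := μ)
    (fun n => (walkFiltration_le hmeas n _ (measurableSet_doublingUpTo (X := X))).nullMeasurableSet)
    hanti ⟨0, measure_ne_top _ _⟩
  have hpos : ENNReal.ofReal (c * (13 / 14)) ≤ μ (⋂ n, doublingUpTo X n) := by
    refine ge_of_tendsto hlim ?_
    filter_upwards [eventually_ge_atTop 14] with n hn
    refine ENNReal.ofReal_le_of_le_toReal ((hlower n hn).trans ?_)
    refine mul_le_of_le_one_right measureReal_nonneg ?_
    have hn' : (0 : ℝ) < n := by positivity
    rw [div_le_one hn']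
    linarith
  refine lt_of_lt_of_le (ENNReal.ofReal_pos.2 (by positivity)) (hpos.trans (measure_mono ?_))
  intro ω hω
  exact tendsto_of_isDoubling fun n hn => mem_iInter.1 hω n n hn le_rfl
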